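/- Let Σ = {1,…,d}, let ξ be a symmetric probability measure on Δ(Σ), let κ be a valid selection kernel, and let κ₀(·|u,p) = p for all u. Let ℚ₀ = λ ⊗ ξ ⊗ κ₀ and ℚ₁ = λ ⊗ ξ ⊗ κ be the joint laws of triples (U,P,A), where λ is the uniform distribution on [0,1], P ~ ξ, and A ~ κ₀(·|U,P) resp. κ(·|U,P). For k ∈ {0,1}, let ℙ_k be the law of (U_1,A_1,…,U_n,A_n) when the triples (U_t,P_t,A_t)_{t=1}^n are i.i.d. with law ℚ_k. Let δ ∈ (0,1/16) and suppose T is a measurable {0,1}-valued function of (U_1,A_1,…,U_n,A_n) with ℙ₀(T = 0) ≥ 1 − δ and ℙ₁(T = 1) ≥ 1 − δ. Then for every ε ∈ (0,1/2), with P ~ ξ, n ≥ min( 1/(2·E[G^1(P_ε)]), log(1/(16δ)) / (16·E[G^{1/2}(P_ε^c)]²) ). -/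

import Mathlib

open MeasureTheory ProbabilityTheory

/-- The probability measure on `Fin d` with mass function `v`. -/
noncomputable def vecMeasure {d : ℕ} (v : Fin d → ℝ) : Measure (Fin d) :=
  ∑ a, ENNReal.ofReal (v a) • Measure.dirac a

/-- The joint law `λ ⊗ ξ ⊗ κ` of a triple `(U, P, A)` where `U` is uniform on
`[0,1]`, `P ∼ ξ` and `A ∼ κ(·|U,P)`. -/
noncomputable def tripleLaw {d : ℕ} (ξ : Measure (Fin d → ℝ))
    (κ : ℝ → (Fin d → ℝ) → Fin d → ℝ) : Measure ((ℝ × (Fin d → ℝ)) × Fin d) :=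
  ((volume.restrict (Set.Icc (0:ℝ) 1)).prod ξ).bind
    (fun x => (Measure.dirac x).prod (vecMeasure (κ x.1 x.2)))

/-- The law of `(U_1,A_1,…,U_n,A_n)` when the triples `(U_t,P_t,A_t)` are
i.i.d. with law `λ ⊗ ξ ⊗ κ`. -/
noncomputable def processLaw {d : ℕ} (n : ℕ) (ξ : Measure (Fin d → ℝ))
    (κ : ℝ → (Fin d → ℝ) → Fin d → ℝ) : Measure (Fin n → ℝ × Fin d) :=
  Measure.pi fun _ : Fin n =>
    Measure.map (fun x : (ℝ × (Fin d → ℝ)) × Fin d => (x.1.1, x.2))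
      (tripleLaw ξ κ)

/-- `p_ε(a) = p(a)·1(p(a) ≤ ε)`. -/
noncomputable def peps {d : ℕ} (ε : ℝ) (p : Fin d → ℝ) : Fin d → ℝ :=
  fun a => if p a ≤ ε then p a else 0

/-- `p_ε^c(a) = p(a)·1(p(a) > ε)`. -/
noncomputable def pepsC {d : ℕ} (ε : ℝ) (p : Fin d → ℝ) : Fin d → ℝ :=
  fun a => if ε < p a then p a else 0

namespace WMProof

theorem lintegral_pi_prod {X : Type*} [MeasurableSpace X] (μ : Measure X) [SigmaFinite μ] :
    ∀ (n : ℕ) (f : Fin n → X → ENNReal), (∀ i, Measurable (f i)) →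
    ∫⁻ x : Fin n → X, ∏ i, f i (x i) ∂(Measure.pi fun _ => μ) = ∏ i, ∫⁻ x, f i x ∂μ := by
  intro n
  induction n with
  | zero => intro f hf; simp
  | succ n ih =>
    intro f hf
    have hmp := (measurePreserving_piFinSuccAbove (fun _ : Fin (n+1) => μ) 0).symm
    rw [← hmp.lintegral_comp_emb (MeasurableEquiv.measurableEmbedding _)]
    rw [lintegral_prod]
    · simp only [Fin.prod_univ_succ]
      simp [MeasurableEquiv.piFinSuccAbove, Fin.insertNthEquiv]
      have h2 : ∀ x : X, ∫⁻ a : Fin n → X, f 0 x * ∏ i, f i.succ (a i) ∂(Measure.pi fun _ => μ)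
          = f 0 x * ∏ i : Fin n, ∫⁻ x, f i.succ x ∂μ := by
        intro x
        rw [lintegral_const_mul, ih _ (fun i => hf _)]
        exact Finset.measurable_prod _ fun i _ => (hf _).comp (measurable_pi_apply i)
      simp only [h2]
      rw [lintegral_mul_const _ (hf 0)]
    · refine Measurable.aemeasurable ?_
      refine Finset.measurable_prod _ fun i _ => (hf _).comp ?_
      exact (measurable_pi_apply i).comp (MeasurableEquiv.measurable _)

theorem pi_withDensity' {X : Type*} [MeasurableSpace X] (μ : Measure X) [IsFiniteMeasure μ]
    (n : ℕ) (f : X → ENNReal) (hf : Measurable f) (hfin : ∫⁻ x, f x ∂μ ≠ ⊤) :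
    Measure.pi (fun _ : Fin n => μ.withDensity f) =
      (Measure.pi (fun _ : Fin n => μ)).withDensity (fun x => ∏ i, f (x i)) := by
  have : IsFiniteMeasure (μ.withDensity f) := isFiniteMeasure_withDensity hfin
  refine Measure.pi_eq fun s hs => ?_
  rw [withDensity_apply _ (MeasurableSet.univ_pi hs),
    ← lintegral_indicator (MeasurableSet.univ_pi hs)]
  have h1 : ∀ x : Fin n → X, (Set.univ.pi s).indicator (fun x => ∏ i, f (x i)) x
      = ∏ i, (s i).indicator f (x i) := by
    intro x
    by_cases hx : x ∈ Set.univ.pi s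
    · rw [Set.indicator_of_mem hx]
      exact Finset.prod_congr rfl fun i _ => (Set.indicator_of_mem (hx i trivial) _).symm
    · rw [Set.indicator_of_notMem hx]
      simp only [Set.mem_pi, Set.mem_univ, true_implies, not_forall] at hx
      obtain ⟨i, hi⟩ := hx
      exact (Finset.prod_eq_zero (Finset.mem_univ i) (Set.indicator_of_notMem hi _)).symm
  simp only [h1]
  rw [lintegral_pi_prod μ n (fun i => (s i).indicator f) (fun i => hf.indicator (hs i))]
  exact Finset.prod_congr rfl fun i _ => by
    rw [withDensity_apply _ (hs i), lintegral_indicator (hs i)]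

/-- uniform measure on the unit interval -/
noncomputable abbrev lam : Measure ℝ := volume.restrict (Set.Icc (0:ℝ) 1)

instance : IsProbabilityMeasure lam := ⟨by simp [lam]⟩

/-- base measure -/
noncomputable abbrev base (d : ℕ) : Measure (ℝ × Fin d) := lam.prod Measure.count

/-- density of `(U, A)` -/
noncomputable def dens {d : ℕ} (ξ : Measure (Fin d → ℝ))
    (κ : ℝ → (Fin d → ℝ) → Fin d → ℝ) : ℝ × Fin d → ENNReal :=
  fun y => ∫⁻ p, ENNReal.ofReal (κ y.1 p y.2) ∂ξ

theorem dens_meas {d : ℕ} (ξ : Measure (Fin d → ℝ)) [SFinite ξ]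
    (κ : ℝ → (Fin d → ℝ) → Fin d → ℝ)
    (hκ : Measurable fun x : ℝ × (Fin d → ℝ) => κ x.1 x.2) : Measurable (dens ξ κ) := by
  refine measurable_from_prod_countable_left fun a => ?_
  unfold dens
  refine Measurable.lintegral_prod_right' (f := fun x : ℝ × (Fin d → ℝ) =>
    ENNReal.ofReal (κ x.1 x.2 a)) ?_
  exact ENNReal.measurable_ofReal.comp ((measurable_pi_apply a).comp hκ)

theorem lintegral_base {d : ℕ} (f : ℝ × Fin d → ENNReal) (hf : Measurable f) :
    ∫⁻ y, f y ∂(base d) = ∑ a, ∫⁻ u, f (u, a) ∂lam := by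
  rw [lintegral_prod _ hf.aemeasurable]
  simp only [lintegral_count, tsum_fintype]
  rw [lintegral_finsetSum]
  intro a _
  exact hf.comp measurable_prodMk_right

instance {d : ℕ} (v : Fin d → ℝ) : IsFiniteMeasure (vecMeasure v) := by
  unfold vecMeasure
  refine ⟨?_⟩
  simp

theorem vecMeasure_apply {d : ℕ} (v : Fin d → ℝ) (s : Set (Fin d)) :
    vecMeasure v s = ∑ a, ENNReal.ofReal (v a) * s.indicator 1 a := by
  unfold vecMeasure
  simp

theorem single_law {d : ℕ} (ξ : Measure (Fin d → ℝ)) [IsProbabilityMeasure ξ]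
    (κ : ℝ → (Fin d → ℝ) → Fin d → ℝ)
    (hκ : Measurable fun x : ℝ × (Fin d → ℝ) => κ x.1 x.2) :
    Measure.map (fun x : (ℝ × (Fin d → ℝ)) × Fin d => (x.1.1, x.2)) (tripleLaw ξ κ)
      = (base d).withDensity (dens ξ κ) := by
  have hκa : ∀ a, Measurable fun x : ℝ × (Fin d → ℝ) => ENNReal.ofReal (κ x.1 x.2 a) := fun a =>
    ENNReal.measurable_ofReal.comp ((measurable_pi_apply a).comp hκ)
  have happ : ∀ (x : ℝ × (Fin d → ℝ)) (s : Set ((ℝ × (Fin d → ℝ)) × Fin d)), MeasurableSet s →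
      ((Measure.dirac x).prod (vecMeasure (κ x.1 x.2))) s
        = ∑ a, ENNReal.ofReal (κ x.1 x.2 a) * s.indicator 1 (x, a) := by
    intro x s hs
    rw [Measure.dirac_prod, Measure.map_apply measurable_prodMk_left hs, vecMeasure_apply]
    rfl
  have hker : Measurable (fun x : ℝ × (Fin d → ℝ) =>
      (Measure.dirac x).prod (vecMeasure (κ x.1 x.2))) := by
    refine Measure.measurable_of_measurable_coe _ fun s hs => ?_
    simp only [happ _ s hs]
    refine Finset.measurable_sum _ fun a _ => (hκa a).mul ?_
    exact (measurable_one.indicator hs).comp measurable_prodMk_right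
  have hg : Measurable (fun x : (ℝ × (Fin d → ℝ)) × Fin d => (x.1.1, x.2)) := by fun_prop
  ext s hs
  rw [Measure.map_apply hg hs, tripleLaw, Measure.bind_apply (hg hs) hker.aemeasurable,
    withDensity_apply _ hs, ← lintegral_indicator hs,
    lintegral_base _ ((dens_meas ξ κ hκ).indicator hs)]
  simp only [happ _ _ (hg hs)]
  have hm : ∀ a, Measurable fun x : ℝ × (Fin d → ℝ) => ENNReal.ofReal (κ x.1 x.2 a) *
      ((fun x : (ℝ × (Fin d → ℝ)) × Fin d => (x.1.1, x.2)) ⁻¹' s).indicator 1 (x, a) := fun a =>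
    (hκa a).mul ((measurable_one.indicator (hg hs)).comp measurable_prodMk_right)
  rw [lintegral_finsetSum _ fun a _ => hm a]
  refine Finset.sum_congr rfl fun a _ => ?_
  rw [lintegral_prod _ (hm a).aemeasurable]
  refine lintegral_congr fun u => ?_
  by_cases hu : (u, a) ∈ s
  · rw [Set.indicator_of_mem hu]
    refine lintegral_congr fun p => ?_
    rw [Set.indicator_of_mem (by exact hu)]; simp
  · rw [Set.indicator_of_notMem hu]
    have : ∀ p, ((fun x : (ℝ × (Fin d → ℝ)) × Fin d => (x.1.1, x.2)) ⁻¹' s).indicator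
      (1 : (ℝ × (Fin d → ℝ)) × Fin d → ENNReal) ((u, p), a) = 0 := fun p => Set.indicator_of_notMem (by exact hu) _
    simp [this]

theorem cs_ennreal {X : Type*} [MeasurableSpace X] (μ : Measure X) (f : X → ENNReal)
    (hf : Measurable f) (S : Set X) (hS : MeasurableSet S) :
    (μ.withDensity f S) ^ 2 ≤ μ S * ∫⁻ x, f x ^ 2 ∂μ := by
  rw [withDensity_apply _ hS, ← lintegral_indicator hS]
  have h := ENNReal.lintegral_mul_le_Lp_mul_Lq μ (p := 2) (q := 2)
    (Real.holderConjugate_iff.2 ⟨by norm_num, by norm_num⟩)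
    (f := S.indicator 1) (g := f) (measurable_one.indicator hS).aemeasurable hf.aemeasurable
  have e1 : ∀ x, (S.indicator (1 : X → ENNReal) * f) x = S.indicator f x := by
    intro x; by_cases hx : x ∈ S <;> simp [hx]
  have e2 : ∀ x, S.indicator (1 : X → ENNReal) x ^ (2:ℝ) = S.indicator 1 x := by
    intro x; by_cases hx : x ∈ S <;> simp [hx]
  simp only [e1, e2] at h
  rw [lintegral_indicator_one hS] at h
  calc _ ≤ (μ S ^ (1/2:ℝ) * (∫⁻ x, f x ^ (2:ℝ) ∂μ) ^ (1/2:ℝ)) ^ 2 := by gcongr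
    _ = _ := by
      rw [← ENNReal.mul_rpow_of_nonneg _ _ (by norm_num), ← ENNReal.rpow_natCast,
        ← ENNReal.rpow_mul]
      norm_num

theorem cs_real (μ : Measure ℝ) [IsProbabilityMeasure μ] (x y : ℝ → ℝ)
    (hxx : Integrable (fun u => x u ^ 2) μ) (hyy : Integrable (fun u => y u ^ 2) μ)
    (hxy : Integrable (fun u => x u * y u) μ) (s t : ℝ) (hs : 0 ≤ s) (ht : 0 ≤ t)
    (hx2 : ∫ u, x u ^ 2 ∂μ ≤ s ^ 2) (hy2 : ∫ u, y u ^ 2 ∂μ ≤ t ^ 2) :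
    ∫ u, x u * y u ∂μ ≤ s * t := by
  have key : ∀ c : ℝ, 0 ≤ (∫ u, x u ^ 2 ∂μ) * (c * c) + (2 * ∫ u, x u * y u ∂μ) * c
      + ∫ u, y u ^ 2 ∂μ := by
    intro c
    have : 0 ≤ ∫ u, (c * x u + y u) ^ 2 ∂μ := integral_nonneg fun u => sq_nonneg _
    have e : ∀ u, (c * x u + y u) ^ 2 = (c * c) * x u ^ 2 + (2 * c) * (x u * y u) + y u ^ 2 := by
      intro u; ring
    simp only [e] at this
    have j1 : Integrable (fun u => (c * c) * x u ^ 2 + (2 * c) * (x u * y u)) μ :=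
      (hxx.const_mul _).add (hxy.const_mul _)
    rw [integral_add j1 hyy,
      integral_add (hxx.const_mul _) (hxy.const_mul _), integral_const_mul,
      integral_const_mul] at this
    linarith
  have hd := discrim_le_zero key
  unfold discrim at hd
  have h0 : 0 ≤ ∫ u, y u ^ 2 ∂μ := integral_nonneg fun u => sq_nonneg _
  refine abs_le_of_sq_le_sq' ?_ (by positivity) |>.2
  have := mul_le_mul hx2 hy2 h0 (sq_nonneg s)
  nlinarith

/-- core covariance bound -/
theorem cov_bound (μ : Measure ℝ) [IsProbabilityMeasure μ] (x y : ℝ → ℝ)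
    (hx : Measurable x) (hy : Measurable y) (hx0 : ∀ u, 0 ≤ x u) (hx1 : ∀ u, x u ≤ 1)
    (hy0 : ∀ u, 0 ≤ y u) (hy1 : ∀ u, y u ≤ 1) (p q s t : ℝ) (hs : 0 ≤ s) (ht : 0 ≤ t)
    (hp : ∫ u, x u ∂μ = p) (hq : ∫ u, y u ∂μ = q)
    (hxs : ∫ u, x u ^ 2 ∂μ ≤ p ^ 2 + s ^ 2) (hyt : ∫ u, y u ^ 2 ∂μ ≤ q ^ 2 + t ^ 2) :
    ∫ u, x u * y u ∂μ ≤ p * q + s * t := by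
  have ix : Integrable x μ := Integrable.of_bound hx.aestronglyMeasurable 1
    (.of_forall fun u => by rw [Real.norm_of_nonneg (hx0 u)]; exact hx1 u)
  have iy : Integrable y μ := Integrable.of_bound hy.aestronglyMeasurable 1
    (.of_forall fun u => by rw [Real.norm_of_nonneg (hy0 u)]; exact hy1 u)
  have ixx : Integrable (fun u => x u ^ 2) μ :=
    Integrable.of_bound (hx.pow_const 2).aestronglyMeasurable 1
    (.of_forall fun u => by
      rw [Real.norm_of_nonneg (sq_nonneg _)]; exact pow_le_one₀ (hx0 u) (hx1 u))
  have iyy : Integrable (fun u => y u ^ 2) μ :=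
    Integrable.of_bound (hy.pow_const 2).aestronglyMeasurable 1
    (.of_forall fun u => by
      rw [Real.norm_of_nonneg (sq_nonneg _)]; exact pow_le_one₀ (hy0 u) (hy1 u))
  have ixy : Integrable (fun u => x u * y u) μ :=
    Integrable.of_bound (hx.mul hy).aestronglyMeasurable 1
    (.of_forall fun u => by
      rw [Real.norm_of_nonneg (mul_nonneg (hx0 u) (hy0 u))]
      exact mul_le_one₀ (hx1 u) (hy0 u) (hy1 u))
  have sqe : ∀ (z : ℝ → ℝ) (r : ℝ), Integrable z μ → Integrable (fun u => z u ^ 2) μ →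
      ∫ u, z u ∂μ = r → Integrable (fun u => (z u - r) ^ 2) μ ∧
      ∫ u, (z u - r) ^ 2 ∂μ = ∫ u, z u ^ 2 ∂μ - r ^ 2 := by
    intro z r iz izz hz
    have e : (fun u => (z u - r) ^ 2) = fun u => z u ^ 2 - (2 * r) * z u + r ^ 2 := by
      funext u; ring
    rw [e]
    refine ⟨(izz.sub (iz.const_mul _)).add (integrable_const _), ?_⟩
    have j1 : Integrable (fun u => z u ^ 2 - (2 * r) * z u) μ := izz.sub (iz.const_mul _)
    rw [integral_add j1 (integrable_const _),
      integral_sub izz (iz.const_mul _), integral_const_mul, hz]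
    simp; ring
  obtain ⟨jx, ex⟩ := sqe x p ix ixx hp
  obtain ⟨jy, ey⟩ := sqe y q iy iyy hq
  have e : (fun u => (x u - p) * (y u - q)) = fun u => x u * y u - q * x u - p * y u + p * q := by
    funext u; ring
  have jxy : Integrable (fun u => (x u - p) * (y u - q)) μ := by
    rw [e]
    exact ((ixy.sub (ix.const_mul _)).sub (iy.const_mul _)).add (integrable_const _)
  have h := cs_real μ (fun u => x u - p) (fun u => y u - q) jx jy jxy s t hs ht
    (by rw [ex]; linarith) (by rw [ey]; linarith)
  have h2 : ∫ u, (x u - p) * (y u - q) ∂μ = ∫ u, x u * y u ∂μ - p * q := by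
    have j1 : Integrable (fun u => x u * y u - q * x u) μ := ixy.sub (ix.const_mul _)
    have j2 : Integrable (fun u => x u * y u - q * x u - p * y u) μ := j1.sub (iy.const_mul _)
    rw [e, integral_add j2 (integrable_const _), integral_sub j1 (iy.const_mul _),
      integral_sub ixy (ix.const_mul _), integral_const_mul, integral_const_mul, hp, hq]
    simp; ring
  rw [h2] at h
  linarith

/-- membership in the simplex -/
def Simp {d : ℕ} (p : Fin d → ℝ) : Prop := (∀ a, 0 ≤ p a) ∧ ∑ a, p a = 1

theorem Simp.le_one {d : ℕ} {p : Fin d → ℝ} (h : Simp p) (a : Fin d) : p a ≤ 1 := by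
  rw [← h.2]
  exact Finset.single_le_sum (fun i _ => h.1 i) (Finset.mem_univ a)

/-- truncated kernel -/
noncomputable def kH {d : ℕ} (ε : ℝ) (κ : ℝ → (Fin d → ℝ) → Fin d → ℝ) :
    ℝ → (Fin d → ℝ) → Fin d → ℝ :=
  fun u p a => if p a ≤ ε then κ u p a * p a else κ u p a

/-- dominating kernel -/
noncomputable def kW {d : ℕ} (ε : ℝ) (κ : ℝ → (Fin d → ℝ) → Fin d → ℝ) :
    ℝ → (Fin d → ℝ) → Fin d → ℝ :=
  fun u p a => if p a ≤ ε then p a else κ u p a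

section
variable {d : ℕ} {κ : ℝ → (Fin d → ℝ) → Fin d → ℝ}

theorem kappa_meas (hκ : Measurable fun x : ℝ × (Fin d → ℝ) => κ x.1 x.2) (a : Fin d) :
    Measurable fun x : ℝ × (Fin d → ℝ) => κ x.1 x.2 a := (measurable_pi_apply a).comp hκ

theorem coord_meas (a : Fin d) : Measurable fun x : ℝ × (Fin d → ℝ) => x.2 a :=
  (measurable_pi_apply a).comp measurable_snd

theorem kH_meas (ε : ℝ) (hκ : Measurable fun x : ℝ × (Fin d → ℝ) => κ x.1 x.2) :
    Measurable fun x : ℝ × (Fin d → ℝ) => kH ε κ x.1 x.2 := by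
  refine measurable_pi_lambda _ fun a => ?_
  exact Measurable.ite (measurableSet_le (coord_meas a) measurable_const)
    ((kappa_meas hκ a).mul (coord_meas a)) (kappa_meas hκ a)

theorem kW_meas (ε : ℝ) (hκ : Measurable fun x : ℝ × (Fin d → ℝ) => κ x.1 x.2) :
    Measurable fun x : ℝ × (Fin d → ℝ) => kW ε κ x.1 x.2 := by
  refine measurable_pi_lambda _ fun a => ?_
  exact Measurable.ite (measurableSet_le (coord_meas a) measurable_const)
    (coord_meas a) (kappa_meas hκ a)

theorem sym_lint (ξ : Measure (Fin d → ℝ))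
    (hξ_sym : ∀ σ : Equiv.Perm (Fin d), Measure.map (fun p => p ∘ σ) ξ = ξ)
    (φ : ℝ → ENNReal) (hφ : Measurable φ) (a : Fin d) :
    (d : ENNReal) * ∫⁻ p, φ (p a) ∂ξ = ∫⁻ p, ∑ b, φ (p b) ∂ξ := by
  have hm : ∀ b : Fin d, Measurable fun p : Fin d → ℝ => φ (p b) := fun b =>
    hφ.comp (measurable_pi_apply b)
  have h : ∀ b, ∫⁻ p, φ (p b) ∂ξ = ∫⁻ p, φ (p a) ∂ξ := by
    intro b
    conv_lhs => rw [← hξ_sym (Equiv.swap a b)]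
    rw [lintegral_map (hm b)]
    · simp
    · exact measurable_pi_lambda _ fun i => measurable_pi_apply _
  rw [lintegral_finsetSum _ fun b _ => hm b]
  simp [h]

theorem lint_coord (ξ : Measure (Fin d → ℝ)) [IsProbabilityMeasure ξ]
    (hS : ∀ᵐ p ∂ξ, Simp p)
    (hξ_sym : ∀ σ : Equiv.Perm (Fin d), Measure.map (fun p => p ∘ σ) ξ = ξ) (a : Fin d) :
    ∫⁻ p, ENNReal.ofReal (p a) ∂ξ = (d : ENNReal)⁻¹ := by
  have h := sym_lint ξ hξ_sym ENNReal.ofReal ENNReal.measurable_ofReal a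
  have h2 : ∫⁻ p, ∑ b, ENNReal.ofReal (p b) ∂ξ = 1 := by
    rw [lintegral_congr_ae (g := fun _ => 1)]
    · simp
    · filter_upwards [hS] with p hp
      rw [← ENNReal.ofReal_sum_of_nonneg fun i _ => hp.1 i, hp.2]; simp
  rw [h2] at h
  exact ENNReal.eq_inv_of_mul_eq_one_left (by rw [mul_comm]; exact h)

theorem mass_one (ξ : Measure (Fin d → ℝ)) [IsProbabilityMeasure ξ]
    (hκ : Measurable fun x : ℝ × (Fin d → ℝ) => κ x.1 x.2)
    (hκ_nonneg : ∀ u p a, 0 ≤ κ u p a) (hκ_sum : ∀ u p, ∑ a, κ u p a = 1) :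
    ∫⁻ y, dens ξ κ y ∂(base d) = 1 := by
  rw [lintegral_base _ (dens_meas ξ κ hκ), ← lintegral_finsetSum]
  · unfold dens
    have : ∀ u : ℝ, ∑ a, ∫⁻ p, ENNReal.ofReal (κ u p a) ∂ξ = 1 := by
      intro u
      rw [← lintegral_finsetSum]
      · simp_rw [← ENNReal.ofReal_sum_of_nonneg fun a _ => hκ_nonneg u _ a, hκ_sum]
        simp
      · intro a _
        exact ENNReal.measurable_ofReal.comp ((kappa_meas hκ a).comp measurable_prodMk_left)
    simp [this]
  · intro a _
    exact (dens_meas ξ κ hκ).comp measurable_prodMk_right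

theorem lint_u (hκ : Measurable fun x : ℝ × (Fin d → ℝ) => κ x.1 x.2)
    (hκ_nonneg : ∀ u p a, 0 ≤ κ u p a)
    (hκ_le : ∀ u p a, κ u p a ≤ 1)
    (hv : ∀ p, Simp p → ∀ a, ∫ u, κ u p a ∂lam = p a) (p : Fin d → ℝ) (hp : Simp p) (a : Fin d) :
    ∫⁻ u, ENNReal.ofReal (κ u p a) ∂lam = ENNReal.ofReal (p a) := by
  rw [← hv p hp a, ofReal_integral_eq_lintegral_ofReal]
  · exact Integrable.of_bound
      ((kappa_meas hκ a).comp measurable_prodMk_right).aestronglyMeasurable 1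
      (.of_forall fun u => by rw [Real.norm_of_nonneg (hκ_nonneg _ _ _)]; exact hκ_le _ _ _)
  · exact .of_forall fun u => hκ_nonneg _ _ _

theorem peps_meas (ε : ℝ) (a : Fin d) : Measurable fun p : Fin d → ℝ => peps ε p a :=
  Measurable.ite (measurableSet_le (measurable_pi_apply a) measurable_const)
    (measurable_pi_apply a) measurable_const

theorem pepsC_meas (ε : ℝ) (a : Fin d) : Measurable fun p : Fin d → ℝ => pepsC ε p a :=
  Measurable.ite (measurableSet_lt measurable_const (measurable_pi_apply a))
    (measurable_pi_apply a) measurable_const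

theorem peps_mem (ε : ℝ) {p : Fin d → ℝ} (hp : Simp p) (a : Fin d) :
    0 ≤ peps ε p a ∧ peps ε p a ≤ p a := by
  unfold peps; split_ifs
  · exact ⟨hp.1 a, le_rfl⟩
  · exact ⟨le_rfl, hp.1 a⟩

theorem pepsC_mem (ε : ℝ) {p : Fin d → ℝ} (hp : Simp p) (a : Fin d) :
    0 ≤ pepsC ε p a ∧ pepsC ε p a ≤ 1 := by
  unfold pepsC; split_ifs
  · exact ⟨hp.1 a, hp.le_one a⟩
  · exact ⟨le_rfl, zero_le_one⟩

theorem G1_integrable (ξ : Measure (Fin d → ℝ)) [IsProbabilityMeasure ξ] (ε : ℝ)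
    (hS : ∀ᵐ p ∂ξ, Simp p) :
    Integrable (fun p => ∑ a, peps ε p a * (1 - peps ε p a)) ξ := by
  refine integrable_finsetSum _ fun a _ => ?_
  refine Integrable.of_bound ((peps_meas ε a).mul
    (measurable_const.sub (peps_meas ε a))).aestronglyMeasurable 1 ?_
  filter_upwards [hS] with p hp
  have h1 := peps_mem ε hp a
  have h2 := hp.le_one a
  rw [Real.norm_of_nonneg (mul_nonneg h1.1 (by linarith))]
  nlinarith

theorem mass_H (ξ : Measure (Fin d → ℝ)) [IsProbabilityMeasure ξ] (ε : ℝ)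
    (hS : ∀ᵐ p ∂ξ, Simp p)
    (hκ : Measurable fun x : ℝ × (Fin d → ℝ) => κ x.1 x.2)
    (hκ_nonneg : ∀ u p a, 0 ≤ κ u p a)
    (hκ_le : ∀ u p a, κ u p a ≤ 1)
    (hv : ∀ p, Simp p → ∀ a, ∫ u, κ u p a ∂lam = p a) :
    ∫⁻ y, dens ξ (kH ε κ) y ∂(base d) =
      ENNReal.ofReal (1 - ∫ p, ∑ a, peps ε p a * (1 - peps ε p a) ∂ξ) := by
  have hHa : ∀ a, Measurable fun x : ℝ × (Fin d → ℝ) => ENNReal.ofReal (kH ε κ x.1 x.2 a) :=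
    fun a => ENNReal.measurable_ofReal.comp (kappa_meas (kH_meas ε hκ) a)
  rw [lintegral_base _ (dens_meas ξ _ (kH_meas ε hκ))]
  unfold dens
  have h1 : ∀ a : Fin d, ∫⁻ u, ∫⁻ p, ENNReal.ofReal (kH ε κ u p a) ∂ξ ∂lam
      = ∫⁻ p, ∫⁻ u, ENNReal.ofReal (kH ε κ u p a) ∂lam ∂ξ := fun a =>
    lintegral_lintegral_swap (hHa a).aemeasurable
  simp only [h1]
  rw [← lintegral_finsetSum]
  swap
  · intro a _
    exact (hHa a).lintegral_prod_left'
  have h2 : 1 - ∫ p, ∑ a, peps ε p a * (1 - peps ε p a) ∂ξ =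
      ∫ p, (1 - ∑ a, peps ε p a * (1 - peps ε p a)) ∂ξ := by
    rw [integral_sub (integrable_const _) (G1_integrable ξ ε hS)]; simp
  have hterm : ∀ p : Fin d → ℝ, Simp p → ∀ a, 0 ≤ p a - peps ε p a * (1 - peps ε p a) := by
    intro p hp a
    have h1 := peps_mem ε hp a
    nlinarith
  have hsum : ∀ p : Fin d → ℝ, Simp p → (1 - ∑ a, peps ε p a * (1 - peps ε p a)) =
      ∑ a, (p a - peps ε p a * (1 - peps ε p a)) := by
    intro p hp
    rw [Finset.sum_sub_distrib, hp.2]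
  rw [h2, ofReal_integral_eq_lintegral_ofReal]
  · refine lintegral_congr_ae ?_
    filter_upwards [hS] with p hp
    rw [hsum p hp, ENNReal.ofReal_sum_of_nonneg fun a _ => hterm p hp a]
    refine Finset.sum_congr rfl fun a _ => ?_
    have hl := lint_u hκ hκ_nonneg hκ_le hv p hp a
    by_cases h : p a ≤ ε
    · simp only [kH, peps, h, if_true]
      simp_rw [fun u => ENNReal.ofReal_mul (q := p a) (hκ_nonneg u p a)]
      have hmu : Measurable fun u => ENNReal.ofReal (κ u p a) := ENNReal.measurable_ofReal.comp
        ((kappa_meas hκ a).comp measurable_prodMk_right)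
      rw [lintegral_mul_const _ hmu, hl, ← ENNReal.ofReal_mul (hp.1 a)]
      congr 1; ring
    · simp only [kH, peps, h, if_false]
      rw [hl]; simp
  · exact (integrable_const _).sub (G1_integrable ξ ε hS)
  · filter_upwards [hS] with p hp
    rw [hsum p hp]
    exact Finset.sum_nonneg fun a _ => hterm p hp a

/-- standard deviation term -/
noncomputable def sd (ε : ℝ) (x : ℝ) : ℝ :=
  Real.sqrt ((if ε < x then x else 0) * (1 - (if ε < x then x else 0)))

theorem sd_meas (ε : ℝ) : Measurable (sd ε) := by
  have : Measurable fun x : ℝ => if ε < x then x else 0 :=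
    Measurable.ite (measurableSet_lt measurable_const measurable_id) measurable_id measurable_const
  exact (this.mul (measurable_const.sub this)).sqrt

theorem lint_sd (hd : 0 < d) (ξ : Measure (Fin d → ℝ)) [IsProbabilityMeasure ξ] (ε : ℝ)
    (hS : ∀ᵐ p ∂ξ, Simp p)
    (hξ_sym : ∀ σ : Equiv.Perm (Fin d), Measure.map (fun p => p ∘ σ) ξ = ξ) (a : Fin d) :
    ∫⁻ p, ENNReal.ofReal (sd ε (p a)) ∂ξ = (d : ENNReal)⁻¹ * ENNReal.ofReal
      (∫ p, ∑ a, Real.sqrt (pepsC ε p a * (1 - pepsC ε p a)) ∂ξ) := by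
  have h := sym_lint ξ hξ_sym (fun x => ENNReal.ofReal (sd ε x))
    (ENNReal.measurable_ofReal.comp (sd_meas ε)) a
  have h2 : ENNReal.ofReal (∫ p, ∑ a, Real.sqrt (pepsC ε p a * (1 - pepsC ε p a)) ∂ξ) =
      ∫⁻ p, ∑ b, ENNReal.ofReal (sd ε (p b)) ∂ξ := by
    rw [ofReal_integral_eq_lintegral_ofReal]
    · refine lintegral_congr fun p => ?_
      rw [ENNReal.ofReal_sum_of_nonneg fun a _ => Real.sqrt_nonneg _]
      rfl
    · refine integrable_finsetSum _ fun a _ => ?_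
      refine Integrable.of_bound ((pepsC_meas ε a).mul
        (measurable_const.sub (pepsC_meas ε a))).sqrt.aestronglyMeasurable 1 ?_
      filter_upwards [hS] with p hp
      have h1 := pepsC_mem ε hp a
      rw [Real.norm_of_nonneg (Real.sqrt_nonneg _)]
      refine Real.sqrt_le_iff.2 ⟨zero_le_one, ?_⟩
      nlinarith
    · exact .of_forall fun p => Finset.sum_nonneg fun a _ => Real.sqrt_nonneg _
  rw [h2, ← h, ← mul_assoc, ENNReal.inv_mul_cancel, one_mul]
  · exact_mod_cast hd.ne'
  · exact ENNReal.natCast_ne_top d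

theorem kW_stats (ε : ℝ) (hκ : Measurable fun x : ℝ × (Fin d → ℝ) => κ x.1 x.2)
    (hκ_nonneg : ∀ u p a, 0 ≤ κ u p a)
    (hκ_le : ∀ u p a, κ u p a ≤ 1)
    (hv : ∀ p, Simp p → ∀ a, ∫ u, κ u p a ∂lam = p a) (p : Fin d → ℝ) (hp : Simp p) (a : Fin d) :
    (∀ u, 0 ≤ kW ε κ u p a) ∧ (∀ u, kW ε κ u p a ≤ 1) ∧ ∫ u, kW ε κ u p a ∂lam = p a ∧
    ∫ u, kW ε κ u p a ^ 2 ∂lam ≤ p a ^ 2 + sd ε (p a) ^ 2 := by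
  by_cases h : p a ≤ ε
  · simp only [kW, h, if_true]
    refine ⟨fun _ => hp.1 a, fun _ => hp.le_one a, by simp, ?_⟩
    simp; positivity
  · simp only [kW, h, if_false]
    refine ⟨fun u => hκ_nonneg u p a, fun u => hκ_le u p a, hv p hp a, ?_⟩
    have hsd : sd ε (p a) ^ 2 = p a * (1 - p a) := by
      unfold sd
      rw [if_pos (not_le.1 h), Real.sq_sqrt]
      exact mul_nonneg (hp.1 a) (by linarith [hp.le_one a])
    rw [hsd]
    have hmu : Measurable fun u => κ u p a := (kappa_meas hκ a).comp measurable_prodMk_right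
    have : ∫ u, κ u p a ^ 2 ∂lam ≤ ∫ u, κ u p a ∂lam := by
      refine integral_mono ?_ ?_ ?_
      · exact Integrable.of_bound (hmu.pow_const 2).aestronglyMeasurable 1
          (.of_forall fun u => by
            rw [Real.norm_of_nonneg (sq_nonneg _)]
            exact pow_le_one₀ (hκ_nonneg _ _ _) (hκ_le _ _ _))
      · exact Integrable.of_bound hmu.aestronglyMeasurable 1
          (.of_forall fun u => by rw [Real.norm_of_nonneg (hκ_nonneg _ _ _)]; exact hκ_le _ _ _)
      · intro u
        have h0 := hκ_nonneg u p a
        have h1 := hκ_le u p a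
        show κ u p a ^ 2 ≤ κ u p a
        nlinarith
    rw [hv p hp a] at this
    nlinarith

theorem L2_H (hd : 0 < d) (ξ : Measure (Fin d → ℝ)) [IsProbabilityMeasure ξ] (ε : ℝ)
    (hS : ∀ᵐ p ∂ξ, Simp p)
    (hξ_sym : ∀ σ : Equiv.Perm (Fin d), Measure.map (fun p => p ∘ σ) ξ = ξ)
    (hκ : Measurable fun x : ℝ × (Fin d → ℝ) => κ x.1 x.2)
    (hκ_nonneg : ∀ u p a, 0 ≤ κ u p a)
    (hκ_le : ∀ u p a, κ u p a ≤ 1)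
    (hv : ∀ p, Simp p → ∀ a, ∫ u, κ u p a ∂lam = p a) :
    ∫⁻ y, dens ξ (kH ε κ) y ^ 2 ∂(base d) ≤ (d : ENNReal)⁻¹ * (1 + ENNReal.ofReal
      (∫ p, ∑ a, Real.sqrt (pepsC ε p a * (1 - pepsC ε p a)) ∂ξ) ^ 2) := by
  have hWa : ∀ a, Measurable fun x : ℝ × (Fin d → ℝ) => ENNReal.ofReal (kW ε κ x.1 x.2 a) :=
    fun a => ENNReal.measurable_ofReal.comp (kappa_meas (kW_meas ε hκ) a)
  rw [lintegral_base _ ((dens_meas ξ _ (kH_meas ε hκ)).pow_const 2)]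
  set B := ENNReal.ofReal (∫ p, ∑ a, Real.sqrt (pepsC ε p a * (1 - pepsC ε p a)) ∂ξ) with hB
  have hle : ∀ y, dens ξ (kH ε κ) y ≤ dens ξ (kW ε κ) y := by
    intro y
    refine lintegral_mono_ae ?_
    filter_upwards [hS] with p hp
    refine ENNReal.ofReal_le_ofReal ?_
    unfold kH kW
    split_ifs
    · have := hκ_le y.1 p y.2
      have := hp.1 y.2
      nlinarith
    · exact le_rfl
  have hS1 : ∀ᵐ z ∂(ξ.prod ξ), Simp z.1 := Measure.quasiMeasurePreserving_fst.ae hS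
  have hS2 : ∀ᵐ z ∂(ξ.prod ξ), Simp z.2 := Measure.quasiMeasurePreserving_snd.ae hS
  have hone : ∀ a : Fin d, ∫⁻ u, dens ξ (kH ε κ) (u, a) ^ 2 ∂lam ≤
      (d : ENNReal)⁻¹ ^ 2 * (1 + B ^ 2) := by
    intro a
    have hWm : ∀ u, Measurable fun p => ENNReal.ofReal (kW ε κ u p a) := fun u =>
      (hWa a).comp measurable_prodMk_left
    have hsd0 : ∀ x, 0 ≤ sd ε x := fun x => Real.sqrt_nonneg _
    have hcm : Measurable fun p : Fin d → ℝ => ENNReal.ofReal (p a) :=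
      ENNReal.measurable_ofReal.comp (measurable_pi_apply a)
    have hsm : Measurable fun p : Fin d → ℝ => ENNReal.ofReal (sd ε (p a)) :=
      ENNReal.measurable_ofReal.comp ((sd_meas ε).comp (measurable_pi_apply a))
    calc ∫⁻ u, dens ξ (kH ε κ) (u, a) ^ 2 ∂lam
        ≤ ∫⁻ u, dens ξ (kW ε κ) (u, a) ^ 2 ∂lam := by
          refine lintegral_mono fun u => ?_
          gcongr
          exact hle _
      _ = ∫⁻ u, ∫⁻ z, ENNReal.ofReal (kW ε κ u z.1 a) * ENNReal.ofReal (kW ε κ u z.2 a)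
            ∂(ξ.prod ξ) ∂lam := by
          refine lintegral_congr fun u => ?_
          rw [lintegral_prod_mul (hWm u).aemeasurable (hWm u).aemeasurable, sq]
          rfl
      _ = ∫⁻ z, ∫⁻ u, ENNReal.ofReal (kW ε κ u z.1 a) * ENNReal.ofReal (kW ε κ u z.2 a)
            ∂lam ∂(ξ.prod ξ) := by
          refine lintegral_lintegral_swap (Measurable.aemeasurable ?_)
          have m1 : Measurable fun x : ℝ × ((Fin d → ℝ) × (Fin d → ℝ)) => (x.1, x.2.1) := by
            fun_prop
          have m2 : Measurable fun x : ℝ × ((Fin d → ℝ) × (Fin d → ℝ)) => (x.1, x.2.2) := by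
            fun_prop
          exact ((hWa a).comp m1).mul ((hWa a).comp m2)
      _ ≤ ∫⁻ z, (ENNReal.ofReal (z.1 a) * ENNReal.ofReal (z.2 a) +
            ENNReal.ofReal (sd ε (z.1 a)) * ENNReal.ofReal (sd ε (z.2 a))) ∂(ξ.prod ξ) := by
          refine lintegral_mono_ae ?_
          filter_upwards [hS1, hS2] with z h1 h2
          obtain ⟨x0, x1, xp, xs⟩ := kW_stats ε hκ hκ_nonneg hκ_le hv z.1 h1 a
          obtain ⟨y0, y1, yp, ys⟩ := kW_stats ε hκ hκ_nonneg hκ_le hv z.2 h2 a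
          have hx : Measurable fun u => kW ε κ u z.1 a :=
            (kappa_meas (kW_meas ε hκ) a).comp measurable_prodMk_right
          have hy : Measurable fun u => kW ε κ u z.2 a :=
            (kappa_meas (kW_meas ε hκ) a).comp measurable_prodMk_right
          have hc := cov_bound lam _ _ hx hy x0 x1 y0 y1 _ _ (sd ε (z.1 a)) (sd ε (z.2 a))
            (Real.sqrt_nonneg _) (Real.sqrt_nonneg _) xp yp xs ys
          simp_rw [← fun u => ENNReal.ofReal_mul (q := kW ε κ u z.2 a) (x0 u)]
          rw [← ofReal_integral_eq_lintegral_ofReal]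
          · refine (ENNReal.ofReal_le_ofReal hc).trans ?_
            rw [ENNReal.ofReal_add (mul_nonneg (h1.1 a) (h2.1 a))
              (mul_nonneg (hsd0 _) (hsd0 _)),
              ENNReal.ofReal_mul (h1.1 a), ENNReal.ofReal_mul (hsd0 _)]
          · exact Integrable.of_bound (hx.mul hy).aestronglyMeasurable 1
              (.of_forall fun u => by
                rw [Real.norm_of_nonneg (mul_nonneg (x0 u) (y0 u))]
                exact mul_le_one₀ (x1 u) (y0 u) (y1 u))
          · exact .of_forall fun u => mul_nonneg (x0 u) (y0 u)
      _ = (d : ENNReal)⁻¹ ^ 2 * (1 + B ^ 2) := by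
          have hm1 : Measurable fun z : (Fin d → ℝ) × (Fin d → ℝ) =>
              ENNReal.ofReal (z.1 a) * ENNReal.ofReal (z.2 a) :=
            (hcm.comp measurable_fst).mul (hcm.comp measurable_snd)
          rw [lintegral_add_left hm1,
            lintegral_prod_mul hcm.aemeasurable hcm.aemeasurable,
            lintegral_prod_mul hsm.aemeasurable hsm.aemeasurable,
            lint_coord ξ hS hξ_sym, lint_sd hd ξ ε hS hξ_sym, ← hB]
          ring
  refine (Finset.sum_le_sum fun a _ => hone a).trans ?_
  simp only [Finset.sum_const, Finset.card_univ, Fintype.card_fin, nsmul_eq_mul]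
  rw [← mul_assoc, sq, ← mul_assoc, ENNReal.mul_inv_cancel, one_mul]
  · exact_mod_cast hd.ne'
  · exact ENNReal.natCast_ne_top d

end

end WMProof

/-- Lower bound for watermark detection when the model is unknown: with
`ℙ₀ = processLaw n ξ κ₀` (no watermarking, `κ₀(·|u,p) = p`) and
`ℙ₁ = processLaw n ξ κ`, if a measurable test `T` of `(U_1,A_1,…,U_n,A_n)` has
both error probabilities at most `δ < 1/16`, then for every `ε ∈ (0,1/2)`,
`n ≥ min(1/(2 E[G¹(P_ε)]), log(1/(16δ))/(16 E[G^{1/2}(P_ε^c)]²))`. -/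
theorem watermark_lower_bound_unknown_model {d n : ℕ} (hd : 0 < d) (hn : 1 ≤ n)
    (δ : ℝ) (hδ : δ ∈ Set.Ioo (0:ℝ) (1/16))
    (ξ : Measure (Fin d → ℝ)) [IsProbabilityMeasure ξ]
    (hξ_simplex : ξ {p | (∀ a, 0 ≤ p a) ∧ ∑ a, p a = 1} = 1)
    (hξ_sym : ∀ σ : Equiv.Perm (Fin d), Measure.map (fun p => p ∘ σ) ξ = ξ)
    (κ : ℝ → (Fin d → ℝ) → Fin d → ℝ)
    (hκ_meas : Measurable fun x : ℝ × (Fin d → ℝ) => κ x.1 x.2)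
    (hκ_nonneg : ∀ u p a, 0 ≤ κ u p a) (hκ_sum : ∀ u p, ∑ a, κ u p a = 1)
    (hκ_valid : ∀ p : Fin d → ℝ, (∀ a, 0 ≤ p a) → ∑ a, p a = 1 →
      ∀ a, (∫ u in (0:ℝ)..1, κ u p a) = p a)
    (T : (Fin n → ℝ × Fin d) → Bool) (hT : Measurable T)
    (hT0 : ENNReal.ofReal (1 - δ) ≤
      processLaw n ξ (fun _ p => p) {x | T x = false})
    (hT1 : ENNReal.ofReal (1 - δ) ≤ processLaw n ξ κ {x | T x = true})
    (ε : ℝ) (hε : ε ∈ Set.Ioo (0:ℝ) (1/2)) :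
    min (1 / (2 * ∫ p, ∑ a, peps ε p a * (1 - peps ε p a) ∂ξ))
        (Real.log (1/(16*δ)) /
          (16 * (∫ p, ∑ a, Real.sqrt (pepsC ε p a * (1 - pepsC ε p a)) ∂ξ) ^ 2))
      ≤ (n : ℝ) := by
  obtain ⟨hδ0, hδ1⟩ := hδ
  have hSmeas : MeasurableSet {p : Fin d → ℝ | (∀ a, 0 ≤ p a) ∧ ∑ a, p a = 1} := by
    refine MeasurableSet.inter ?_ ?_
    · have : {p : Fin d → ℝ | ∀ a, 0 ≤ p a} = ⋂ a, {p : Fin d → ℝ | 0 ≤ p a} := by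
        ext p; simp
      change MeasurableSet {p : Fin d → ℝ | ∀ a, 0 ≤ p a}
      rw [this]
      exact MeasurableSet.iInter fun a =>
        measurableSet_le measurable_const (measurable_pi_apply a)
    · exact measurableSet_eq_fun
        (Finset.measurable_sum _ fun a _ => measurable_pi_apply a) measurable_const
  have hS : ∀ᵐ p ∂ξ, WMProof.Simp p := (prob_compl_eq_zero_iff hSmeas).2 hξ_simplex
  have hκ_le : ∀ u p a, κ u p a ≤ 1 := fun u p a => by
    rw [← hκ_sum u p]
    exact Finset.single_le_sum (fun i _ => hκ_nonneg u p i) (Finset.mem_univ a)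
  have hv : ∀ p, WMProof.Simp p → ∀ a, ∫ u, κ u p a ∂WMProof.lam = p a := by
    intro p hp a
    rw [← hκ_valid p hp.1 hp.2 a, intervalIntegral.integral_of_le zero_le_one,
      ← integral_Icc_eq_integral_Ioc]
  have hmassH := WMProof.mass_H ξ ε hS hκ_meas hκ_nonneg hκ_le hv
  have hL2 := WMProof.L2_H hd ξ ε hS hξ_sym hκ_meas hκ_nonneg hκ_le hv
  have hmass1 := WMProof.mass_one ξ hκ_meas hκ_nonneg hκ_sum
  have hB0 : 0 ≤ ∫ p, ∑ a, Real.sqrt (pepsC ε p a * (1 - pepsC ε p a)) ∂ξ :=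
    integral_nonneg fun p => Finset.sum_nonneg fun a _ => Real.sqrt_nonneg _
  set A := ∫ p, ∑ a, peps ε p a * (1 - peps ε p a) ∂ξ with hA
  set B := ∫ p, ∑ a, Real.sqrt (pepsC ε p a * (1 - pepsC ε p a)) ∂ξ with hB
  by_contra hcon
  rw [not_le, lt_min_iff] at hcon
  obtain ⟨hcA, hcB⟩ := hcon
  have hn1 : (1:ℝ) ≤ n := by exact_mod_cast hn
  have hApos : 0 < A := by
    by_contra h
    have : 1 / (2 * A) ≤ 0 := div_nonpos_of_nonneg_of_nonpos zero_le_one (by linarith)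
    linarith
  have hnA : n * A < 1 / 2 := by
    rw [lt_div_iff₀ (by positivity)] at hcA
    linarith
  have hA1 : A < 1 / 2 := by nlinarith
  have hB2 : 0 < B ^ 2 := by
    refine lt_of_le_of_ne (sq_nonneg B) fun h => ?_
    rw [← h] at hcB
    simp at hcB
    linarith
  have hnB : n * B ^ 2 < Real.log (1 / (16 * δ)) := by
    rw [lt_div_iff₀ (by positivity)] at hcB
    nlinarith
  -- densities
  set M := Measure.pi (fun _ : Fin n => WMProof.base d) with hM
  have hdinv : (d : ENNReal)⁻¹ ≠ ⊤ := ENNReal.inv_ne_top.2 (by exact_mod_cast hd.ne')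
  have hP1 : processLaw n ξ κ = M.withDensity (fun x => ∏ i, WMProof.dens ξ κ (x i)) := by
    unfold processLaw
    simp only [WMProof.single_law ξ κ hκ_meas]
    exact WMProof.pi_withDensity' _ n _ (WMProof.dens_meas ξ κ hκ_meas) (by rw [hmass1]; simp)
  have hd0 : WMProof.dens ξ (fun _ p => p) = fun _ : ℝ × Fin d => (d : ENNReal)⁻¹ := by
    funext y
    exact WMProof.lint_coord ξ hS hξ_sym y.2
  have hP0 : processLaw n ξ (fun _ p => p) = ((d : ENNReal)⁻¹) ^ n • M := by
    unfold processLaw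
    simp only [WMProof.single_law ξ (fun _ p => p) measurable_snd, hd0]
    rw [WMProof.pi_withDensity' _ n _ measurable_const]
    · simp only [Finset.prod_const, Finset.card_univ, Fintype.card_fin]
      rw [withDensity_const]
    · rw [lintegral_const]
      exact ENNReal.mul_ne_top hdinv (measure_ne_top _ _)
  have hdensH := WMProof.dens_meas ξ _ (WMProof.kH_meas ε hκ_meas)
  set g : (Fin n → ℝ × Fin d) → ENNReal :=
    fun x => ∏ i, WMProof.dens ξ (WMProof.kH ε κ) (x i) with hg
  have hgm : Measurable g := Finset.measurable_prod _ fun i _ =>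
    hdensH.comp (measurable_pi_apply i)
  set H := M.withDensity g with hH
  have hHle : H ≤ processLaw n ξ κ := by
    rw [hP1]
    refine withDensity_mono (.of_forall fun x => ?_)
    refine Finset.prod_le_prod' fun i _ => ?_
    refine lintegral_mono_ae ?_
    filter_upwards [hS] with p hp
    refine ENNReal.ofReal_le_ofReal ?_
    unfold WMProof.kH
    split_ifs
    · have h1 := hp.le_one (x i).2
      have h2 := hκ_nonneg (x i).1 p (x i).2
      nlinarith
    · exact le_rfl
  have hHuniv : H Set.univ = ENNReal.ofReal ((1 - A) ^ n) := by
    rw [hH, withDensity_apply _ MeasurableSet.univ, Measure.restrict_univ, hg,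
      WMProof.lintegral_pi_prod _ n (fun _ => WMProof.dens ξ (WMProof.kH ε κ)) (fun _ => hdensH)]
    simp only [Finset.prod_const, Finset.card_univ, Fintype.card_fin]
    rw [hmassH, ENNReal.ofReal_pow (by linarith)]
  have hg2 : ∫⁻ x, g x ^ 2 ∂M ≤ ((d : ENNReal)⁻¹) ^ n * ENNReal.ofReal ((1 + B ^ 2) ^ n) := by
    have e : ∀ x, g x ^ 2 = ∏ i, (fun y => WMProof.dens ξ (WMProof.kH ε κ) y ^ 2) (x i) := by
      intro x
      rw [hg]
      simp only [Finset.prod_pow]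
    simp only [e]
    rw [WMProof.lintegral_pi_prod _ n (fun _ y => WMProof.dens ξ (WMProof.kH ε κ) y ^ 2)
      (fun _ => hdensH.pow_const 2)]
    simp only [Finset.prod_const, Finset.card_univ, Fintype.card_fin]
    refine (pow_le_pow_left₀ zero_le hL2 n).trans ?_
    rw [mul_pow, ENNReal.ofReal_pow (by positivity), ENNReal.ofReal_add zero_le_one (by positivity),
      ENNReal.ofReal_pow hB0]
    simp
  set S : Set (Fin n → ℝ × Fin d) := {x | T x = true} with hSdef
  have hSm : MeasurableSet S := hT (measurableSet_singleton true)
  have hSc : {x | T x = false} = Sᶜ := by ext x; simp [hSdef]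
  have tot1 : IsProbabilityMeasure (processLaw n ξ κ) := by
    refine ⟨?_⟩
    rw [hP1, withDensity_apply _ MeasurableSet.univ, Measure.restrict_univ,
      WMProof.lintegral_pi_prod _ n (fun _ => WMProof.dens ξ κ)
        (fun _ => WMProof.dens_meas ξ κ hκ_meas)]
    simp [hmass1]
  have tot0 : IsProbabilityMeasure (processLaw n ξ (fun _ p => p)) := by
    refine ⟨?_⟩
    rw [hP0, hM]
    simp only [Measure.smul_apply, smul_eq_mul, Measure.pi_univ, Finset.prod_const,
      Finset.card_univ, Fintype.card_fin]
    rw [← mul_pow, ← Set.univ_prod_univ, Measure.prod_prod]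
    simp only [measure_univ, one_mul, Measure.count_univ, ENat.card_eq_coe_fintype_card,
      Fintype.card_fin]
    have : (d : ENNReal)⁻¹ * d = 1 :=
      ENNReal.inv_mul_cancel (by exact_mod_cast hd.ne') (ENNReal.natCast_ne_top d)
    simp [this]
  have hsub : (1 : ENNReal) - ENNReal.ofReal (1 - δ) = ENNReal.ofReal δ := by
    rw [← ENNReal.ofReal_one, ← ENNReal.ofReal_sub _ (by linarith)]
    congr 1; ring
  have h1c : processLaw n ξ κ Sᶜ ≤ ENNReal.ofReal δ := by
    rw [prob_compl_eq_one_sub hSm, ← hsub]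
    exact tsub_le_tsub_left hT1 _
  have h0 : processLaw n ξ (fun _ p => p) S ≤ ENNReal.ofReal δ := by
    rw [← compl_compl S, prob_compl_eq_one_sub hSm.compl, ← hsub, ← hSc]
    exact tsub_le_tsub_left hT0 _
  have hber : 1 / 2 ≤ (1 - A) ^ n := by
    have := one_add_mul_le_pow (a := -A) (by linarith) n
    have e : 1 + -A = 1 - A := by ring
    rw [e] at this
    linarith
  have hHS : ENNReal.ofReal (7 / 16) ≤ H S := by
    have h1 : ENNReal.ofReal (1 / 2) ≤ H S + ENNReal.ofReal (1 / 16) := by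
      calc ENNReal.ofReal (1 / 2) ≤ H Set.univ := by
            rw [hHuniv]; exact ENNReal.ofReal_le_ofReal hber
        _ = H S + H Sᶜ := (measure_add_measure_compl hSm).symm
        _ ≤ H S + ENNReal.ofReal (1 / 16) := by
            gcongr
            exact (hHle Sᶜ).trans (h1c.trans (ENNReal.ofReal_le_ofReal hδ1.le))
    have h2 := tsub_le_iff_right.2 h1
    rw [← ENNReal.ofReal_sub _ (by norm_num)] at h2
    norm_num at h2 ⊢
    exact h2
  have hfin : ENNReal.ofReal ((7 / 16) ^ 2) ≤ ENNReal.ofReal (δ * (1 + B ^ 2) ^ n) := by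
    calc ENNReal.ofReal ((7 / 16) ^ 2) = ENNReal.ofReal (7 / 16) ^ 2 := by
          rw [ENNReal.ofReal_pow (by norm_num)]
      _ ≤ H S ^ 2 := by gcongr
      _ ≤ M S * ∫⁻ x, g x ^ 2 ∂M := WMProof.cs_ennreal M g hgm S hSm
      _ ≤ M S * (((d : ENNReal)⁻¹) ^ n * ENNReal.ofReal ((1 + B ^ 2) ^ n)) := by gcongr
      _ = processLaw n ξ (fun _ p => p) S * ENNReal.ofReal ((1 + B ^ 2) ^ n) := by
          rw [hP0, Measure.smul_apply, smul_eq_mul]; ring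
      _ ≤ ENNReal.ofReal δ * ENNReal.ofReal ((1 + B ^ 2) ^ n) := by gcongr
      _ = _ := (ENNReal.ofReal_mul hδ0.le).symm
  rw [ENNReal.ofReal_le_ofReal_iff (by positivity)] at hfin
  have hexp : (1 + B ^ 2) ^ n ≤ 1 / (16 * δ) := by
    calc (1 + B ^ 2) ^ n ≤ Real.exp (B ^ 2) ^ n := by
          gcongr; rw [add_comm]; exact Real.add_one_le_exp _
      _ = Real.exp (n * B ^ 2) := by rw [← Real.exp_nat_mul]
      _ ≤ Real.exp (Real.log (1 / (16 * δ))) := Real.exp_le_exp.2 hnB.le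
      _ = 1 / (16 * δ) := Real.exp_log (by positivity)
  have : δ * (1 + B ^ 2) ^ n ≤ 1 / 16 := by
    calc δ * (1 + B ^ 2) ^ n ≤ δ * (1 / (16 * δ)) := by gcongr
      _ = 1 / 16 := by field_simp
  norm_num at hfin this
  linarith
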